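/- arXiv:math/9406212 — 2 statements merged into one kernel-verified Lean document; each statement's English description precedes it below -/
import Mathlib

section
/- Let $(\Omega,\Sigma,\mu)$ be a probability space, $N \ge 1$, $P = \mu^{\otimes N}$ on $\Omega^N$, and for measurable $A \subseteq \Omega^N$ with $P(A) > 0$ let $f_c(A,x)$ be the Euclidean distance from $0$ to the convex hull $V_A(x)$ of $U_A(x) = \{s \in \{0,1\}^N : \exists y \in A,\ s_i = 0 \Rightarrow x_i = y_i\}$, and $A^c_t = \{x \in \Omega^N : f_c(A,x) \le t\}$. Then for every $t \ge \sqrt{2\log\tfrac{1}{P(A)}}$: $P_*(A^c_t) \ge 1 - \exp\Big(-\tfrac12\Big(t - \sqrt{2\log\tfrac{1}{P(A)}}\Big)^2\Big)$ (inner probability). -/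
open MeasureTheory ENNReal

/-- The product probability `μ^{⊗N}` on `Ω^N`. -/
noncomputable def piP {Ω : Type*} [MeasurableSpace Ω] (μ : Measure Ω) [SigmaFinite μ]
    (N : ℕ) : Measure (Fin N → Ω) :=
  Measure.pi fun _ : Fin N => μ

/-- `U_A(x) = {s ∈ {0,1}^N : ∃ y ∈ A, s_i = 0 → x_i = y_i}`, viewed inside
Euclidean space `ℝ^N`. -/
def convUA {N : ℕ} {Ω : Type*} (A : Set (Fin N → Ω)) (x : Fin N → Ω) :
    Set (EuclideanSpace ℝ (Fin N)) :=
  {s | (∀ i, s i = 0 ∨ s i = 1) ∧ ∃ y ∈ A, ∀ i, s i = 0 → x i = y i}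

/-- `f_c(A,x)`: the Euclidean distance from `0` to the convex hull of `U_A(x)`. -/
noncomputable def fConv {N : ℕ} {Ω : Type*} (A : Set (Fin N → Ω)) (x : Fin N → Ω) : ℝ :=
  Metric.infDist (0 : EuclideanSpace ℝ (Fin N)) (convexHull ℝ (convUA A x))

section OneStep

/-- The extremal one-variable estimate behind the induction, in logarithmic coordinates. -/
lemma exp_sub_quadratic_add_le {α L : ℝ} (hα : 0 < α) (hL : 0 ≤ L) :
    Real.exp (α * L - α * (α + 1) * L ^ 2 / 2) + α * Real.exp (-L) ≤ 1 + α := by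
  set k : ℝ → ℝ := fun L ↦
    Real.exp (α * L - α * (α + 1) * L ^ 2 / 2) + α * Real.exp (-L) with hk
  have hderiv (x : ℝ) : HasDerivAt k
      (Real.exp (α * x - α * (α + 1) * x ^ 2 / 2) * (α * (1 - (α + 1) * x)) -
        α * Real.exp (-x)) x := by
    have h1 : HasDerivAt (fun L : ℝ ↦ α * L - α * (α + 1) * L ^ 2 / 2)
        (α * (1 - (α + 1) * x)) x := by
      refine (((hasDerivAt_id x).const_mul α).sub
        ((((hasDerivAt_id x).pow 2).const_mul (α * (α + 1))).div_const 2)).congr_deriv ?_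
      simp
      ring
    refine (h1.exp.add (((hasDerivAt_id x).neg.exp).const_mul α)).congr_deriv ?_
    simp
    ring
  have hanti : AntitoneOn k (Set.Ici 0) := by
    refine antitoneOn_of_deriv_nonpos (convex_Ici 0)
      (fun x _ ↦ (hderiv x).continuousAt.continuousWithinAt)
      (fun x _ ↦ (hderiv x).differentiableAt.differentiableWithinAt) fun x _ ↦ ?_
    rw [(hderiv x).deriv]
    have h1 : 1 - (α + 1) * x ≤ Real.exp (-((α + 1) * x)) := by
      linarith [Real.add_one_le_exp (-((α + 1) * x))]
    have h2 : Real.exp (α * x - α * (α + 1) * x ^ 2 / 2) * Real.exp (-((α + 1) * x)) ≤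
        Real.exp (-x) := by
      rw [← Real.exp_add]
      refine Real.exp_le_exp.2 ?_
      have : 0 ≤ α * (α + 1) * x ^ 2 := by positivity
      linarith
    have h3 := mul_le_mul_of_nonneg_left h1
      (Real.exp_pos (α * x - α * (α + 1) * x ^ 2 / 2)).le
    nlinarith [mul_le_mul_of_nonneg_left (h3.trans h2) hα.le]
  have h0 := hanti (Set.mem_Ici.2 le_rfl) (Set.mem_Ici.2 hL) hL
  simpa [hk] using h0

/-- The choice of the convexity parameter in Talagrand's induction. -/
lemma exists_interpolation_parameter {α r : ℝ} (hα : 0 < α) (hr1 : r ≤ 1) :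
    ∃ l : ℝ, 0 ≤ l ∧ l ≤ 1 ∧ (r = 0 → l = 0) ∧
      Real.exp (α / (2 * (α + 1)) * (1 - l) ^ 2) * r ^ (-α * l) ≤ 1 + α - α * r := by
  have hα1 : 0 < α + 1 := by linarith
  by_cases hr : r ≤ Real.exp (-(1 / (α + 1)))
  · refine ⟨0, le_rfl, zero_le_one, fun _ ↦ rfl, ?_⟩
    have h := exp_sub_quadratic_add_le hα (L := 1 / (α + 1)) (by positivity)
    have he : α * (1 / (α + 1)) - α * (α + 1) * (1 / (α + 1)) ^ 2 / 2 = α / (2 * (α + 1)) := by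
      field_simp
      ring
    rw [he] at h
    have := mul_le_mul_of_nonneg_left hr hα.le
    simp only [sub_zero, one_pow, mul_one, mul_zero, Real.rpow_zero]
    linarith
  · push Not at hr
    have hrpos : 0 < r := (Real.exp_pos _).trans hr
    obtain ⟨L, hL⟩ : ∃ L, r = Real.exp (-L) := ⟨-Real.log r, by simp [Real.exp_log hrpos]⟩
    have hL0 : 0 ≤ L := by
      rw [hL, Real.exp_le_one_iff] at hr1
      linarith
    have hL1 : (α + 1) * L ≤ 1 := by
      rw [hL, Real.exp_lt_exp] at hr
      have : L < 1 / (α + 1) := by linarith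
      rw [lt_div_iff₀ hα1] at this
      linarith
    refine ⟨1 - (α + 1) * L, by linarith, by nlinarith, fun h ↦ absurd h hrpos.ne', ?_⟩
    have h := exp_sub_quadratic_add_le hα hL0
    rw [hL, ← Real.exp_mul, ← Real.exp_add]
    have he : α / (2 * (α + 1)) * (1 - (1 - (α + 1) * L)) ^ 2 +
        -L * (-α * (1 - (α + 1) * L)) = α * L - α * (α + 1) * L ^ 2 / 2 := by
      field_simp
      ring
    rw [he]
    linarith

/-- Bernoulli's inequality for a negative exponent. -/
lemma one_add_sub_mul_le_rpow_neg {α x : ℝ} (hα : 0 < α) (hx : 0 < x) :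
    1 + α - α * x ≤ x ^ (-α) := by
  rw [Real.rpow_def_of_pos hx]
  have h1 := Real.add_one_le_exp (Real.log x * -α)
  have h2 := mul_le_mul_of_nonneg_left (Real.log_le_sub_one_of_pos hx) hα.le
  linarith

end OneStep

section Geometry

/-- The vertex of the cube with the prescribed set of coordinates equal to one. -/
def cubeVertex {N : ℕ} (s : Fin N → Bool) : EuclideanSpace ℝ (Fin N) :=
  WithLp.toLp 2 fun i ↦ if s i then 1 else 0

/-- The distance from the origin to the convex hull of a set of vertices of the cube. -/
noncomputable def hullDist {N : ℕ} (S : Set (Fin N → Bool)) : ℝ :=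
  Metric.infDist 0 (convexHull ℝ (cubeVertex '' S))

lemma hullDist_nonneg {N : ℕ} (S : Set (Fin N → Bool)) : 0 ≤ hullDist S :=
  Metric.infDist_nonneg

lemma hullDist_le_norm {N : ℕ} {S : Set (Fin N → Bool)} {z : EuclideanSpace ℝ (Fin N)}
    (hz : z ∈ convexHull ℝ (cubeVertex '' S)) : hullDist S ≤ ‖z‖ := by
  simpa [hullDist] using Metric.infDist_le_dist_of_mem (x := 0) hz

lemma exists_norm_eq_hullDist {N : ℕ} {S : Set (Fin N → Bool)} (hS : S.Nonempty) :
    ∃ z ∈ convexHull ℝ (cubeVertex '' S), ‖z‖ = hullDist S := by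
  have hc : IsCompact (convexHull ℝ (cubeVertex '' S)) :=
    (S.toFinite.image cubeVertex).isCompact_convexHull ℝ
  obtain ⟨z, hz, h⟩ := hc.exists_infDist_eq_dist ((hS.image cubeVertex).convexHull) 0
  exact ⟨z, hz, by rw [hullDist, h, dist_zero_left]⟩

lemma cons_mem_convexHull {N : ℕ} {S : Set (Fin N → Bool)} {T : Set (Fin (N + 1) → Bool)}
    {b : Bool} (h : ∀ s ∈ S, Fin.cons b s ∈ T) {z : EuclideanSpace ℝ (Fin N)}
    (hz : z ∈ convexHull ℝ (cubeVertex '' S)) :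
    WithLp.toLp 2 (Fin.cons (if b then 1 else 0) z.ofLp : Fin (N + 1) → ℝ) ∈
      convexHull ℝ (cubeVertex '' T) := by
  suffices convexHull ℝ (cubeVertex '' S) ⊆ {z | WithLp.toLp 2
      (Fin.cons (if b then 1 else 0) z.ofLp : Fin (N + 1) → ℝ) ∈
      convexHull ℝ (cubeVertex '' T)} from this hz
  refine convexHull_min ?_ ?_
  · rintro _ ⟨s, hs, rfl⟩
    refine subset_convexHull ℝ _ ⟨Fin.cons b s, h s hs, ?_⟩
    ext i
    refine Fin.cases ?_ (fun j ↦ ?_) i <;> simp [cubeVertex]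
  · intro x hx y hy p q hp hq hpq
    rw [Set.mem_ofPred_eq]
    convert convex_convexHull ℝ (cubeVertex '' T) hx hy hp hq hpq using 1
    ext i
    refine Fin.cases ?_ (fun j ↦ ?_) i
    · cases b <;> simp [hpq]
    · simp

/-- The convexity inequality that drives the induction on the dimension. -/
lemma hullDist_sq_le {N : ℕ} {S S' : Set (Fin N → Bool)} {T : Set (Fin (N + 1) → Bool)}
    (h0 : ∀ s ∈ S, Fin.cons false s ∈ T) (h1 : ∀ s ∈ S', Fin.cons true s ∈ T)
    (hS' : S'.Nonempty) {l : ℝ} (hl0 : 0 ≤ l) (hl1 : l ≤ 1) (hS : S.Nonempty ∨ l = 0) :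
    hullDist T ^ 2 ≤ (1 - l) ^ 2 + l * hullDist S ^ 2 + (1 - l) * hullDist S' ^ 2 := by
  obtain ⟨w, hw, hw'⟩ := exists_norm_eq_hullDist hS'
  have hw2 := cons_mem_convexHull h1 hw
  rcases hS with hS | rfl
  · obtain ⟨z, hz, hz'⟩ := exists_norm_eq_hullDist hS
    have hz2 := cons_mem_convexHull h0 hz
    have hm := convex_convexHull ℝ (cubeVertex '' T) hz2 hw2 hl0 (sub_nonneg.2 hl1) (by ring)
    refine (pow_le_pow_left₀ (hullDist_nonneg T) (hullDist_le_norm hm) 2).trans ?_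
    rw [← hz', ← hw', EuclideanSpace.norm_sq_eq, EuclideanSpace.norm_sq_eq,
      EuclideanSpace.norm_sq_eq, Fin.sum_univ_succ, Finset.mul_sum, Finset.mul_sum, add_assoc,
      ← Finset.sum_add_distrib]
    refine add_le_add (by simp) (Finset.sum_le_sum fun i _ ↦ ?_)
    simp only [Real.norm_eq_abs, sq_abs, PiLp.add_apply, PiLp.smul_apply, Fin.cons_succ,
      smul_eq_mul]
    nlinarith [mul_nonneg (mul_nonneg hl0 (sub_nonneg.2 hl1)) (sq_nonneg (z i - w i))]
  · refine (pow_le_pow_left₀ (hullDist_nonneg T) (hullDist_le_norm hw2) 2).trans ?_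
    rw [← hw', EuclideanSpace.norm_sq_eq, EuclideanSpace.norm_sq_eq, Fin.sum_univ_succ]
    simp

end Geometry

section Glue

variable {Ω : Type*} {N : ℕ}

/-- Replace the coordinates of `x` selected by `s` by those of `y`. -/
def glue (s : Fin N → Bool) (x y : Fin N → Ω) : Fin N → Ω :=
  fun i ↦ if s i then y i else x i

lemma glue_cons_false (s : Fin N → Bool) (ω η : Ω) (x y : Fin N → Ω) :
    glue (Fin.cons false s : Fin (N + 1) → Bool) (Fin.cons ω x) (Fin.cons η y) =
      Fin.cons ω (glue s x y) := by
  ext i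
  refine Fin.cases ?_ (fun j ↦ ?_) i <;> simp [glue]

lemma glue_cons_true (s : Fin N → Bool) (ω η : Ω) (x y : Fin N → Ω) :
    glue (Fin.cons true s : Fin (N + 1) → Bool) (Fin.cons ω x) (Fin.cons η y) =
      Fin.cons η (glue s x y) := by
  ext i
  refine Fin.cases ?_ (fun j ↦ ?_) i <;> simp [glue]

end Glue

section Measure

variable {Ω : Type*} [MeasurableSpace Ω] {μ : Measure Ω} [IsProbabilityMeasure μ] {N : ℕ}

instance : IsProbabilityMeasure (piP μ N) := by
  unfold piP
  infer_instance

variable (μ N) in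
lemma measurePreserving_cons :
    MeasurePreserving (fun p : Ω × (Fin N → Ω) ↦ (Fin.cons p.1 p.2 : Fin (N + 1) → Ω))
      (μ.prod (piP μ N)) (piP μ (N + 1)) := by
  have h := (measurePreserving_piFinSuccAbove (fun _ : Fin (N + 1) ↦ μ) 0).symm
  have he : ⇑(MeasurableEquiv.piFinSuccAbove (fun _ : Fin (N + 1) ↦ Ω) 0).symm =
      fun p : Ω × (Fin N → Ω) ↦ (Fin.cons p.1 p.2 : Fin (N + 1) → Ω) := by
    ext p : 1
    simp [MeasurableEquiv.piFinSuccAbove]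
    rfl
  rwa [he] at h

lemma measurable_fin_cons :
    Measurable fun p : Ω × (Fin N → Ω) ↦ (Fin.cons p.1 p.2 : Fin (N + 1) → Ω) := by
  refine measurable_pi_iff.2 fun i ↦ ?_
  refine Fin.cases ?_ (fun j ↦ ?_) i
  · simpa using measurable_fst
  · exact (measurable_pi_apply j).comp measurable_snd

lemma piP_succ_apply {S : Set (Fin (N + 1) → Ω)} (hS : MeasurableSet S) :
    piP μ (N + 1) S = ∫⁻ ω, piP μ N {x | Fin.cons ω x ∈ S} ∂μ := by
  rw [← (measurePreserving_cons μ N).measure_preimage hS.nullMeasurableSet,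
    Measure.prod_apply (measurable_fin_cons hS)]
  rfl

lemma piP_succ_apply_symm {S : Set (Fin (N + 1) → Ω)} (hS : MeasurableSet S) :
    piP μ (N + 1) S = ∫⁻ x, μ {ω | Fin.cons ω x ∈ S} ∂(piP μ N) := by
  rw [← (measurePreserving_cons μ N).measure_preimage hS.nullMeasurableSet,
    Measure.prod_apply_symm (measurable_fin_cons hS)]
  rfl

lemma measurable_piP_section {S : Set (Fin (N + 1) → Ω)} (hS : MeasurableSet S) :
    Measurable fun ω ↦ piP μ N {x | Fin.cons ω x ∈ S} :=
  measurable_measure_prodMk_left (measurable_fin_cons hS)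

lemma measurable_measure_section {S : Set (Fin (N + 1) → Ω)} (hS : MeasurableSet S) :
    Measurable fun x : Fin N → Ω ↦ μ {ω | (Fin.cons ω x : Fin (N + 1) → Ω) ∈ S} :=
  measurable_measure_prodMk_right (measurable_fin_cons hS)

lemma measurableSet_section {A : Set (Fin (N + 1) → Ω)} (hA : MeasurableSet A) (ω : Ω) :
    MeasurableSet {x | Fin.cons ω x ∈ A} :=
  (measurable_fin_cons.comp measurable_prodMk_left) hA

variable (μ) in
/-- The essential projection of a set along the first coordinate. -/
def essProj (A : Set (Fin (N + 1) → Ω)) : Set (Fin N → Ω) :=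
  {x | μ {ω | (Fin.cons ω x : Fin (N + 1) → Ω) ∈ A} ≠ 0}

lemma measurableSet_essProj {A : Set (Fin (N + 1) → Ω)} (hA : MeasurableSet A) :
    MeasurableSet (essProj μ A) :=
  (measurable_measure_section hA (measurableSet_singleton 0)).compl

/-- Almost every section has at most the measure of the essential projection. -/
lemma ae_piP_section_le {A : Set (Fin (N + 1) → Ω)} (hA : MeasurableSet A) :
    ∀ᵐ ω ∂μ, piP μ N {x | Fin.cons ω x ∈ A} ≤ piP μ N (essProj μ A) := by
  have htail : Measurable fun x : Fin (N + 1) → Ω ↦ Fin.tail x :=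
    measurable_pi_iff.2 fun i ↦ measurable_pi_apply i.succ
  have hC : MeasurableSet (A \ {x | Fin.tail x ∈ essProj μ A}) :=
    hA.diff (htail (measurableSet_essProj hA))
  have h0 : piP μ (N + 1) (A \ {x | Fin.tail x ∈ essProj μ A}) = 0 := by
    rw [piP_succ_apply_symm hC]
    refine (lintegral_congr fun x ↦ ?_).trans lintegral_zero
    by_cases hx : x ∈ essProj μ A
    · simp [hx]
    · have : μ {ω | (Fin.cons ω x : Fin (N + 1) → Ω) ∈ A} = 0 := not_not.1 hx
      exact measure_mono_null (fun ω hω ↦ hω.1) this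
  rw [piP_succ_apply hC, lintegral_eq_zero_iff (measurable_piP_section hC)] at h0
  filter_upwards [h0] with ω hω
  refine measure_mono_ae ?_
  have hω' : ∀ᵐ x ∂(piP μ N), ¬ (Fin.cons ω x ∈ A \ {x | Fin.tail x ∈ essProj μ A}) := by
    rw [ae_iff]
    simpa using hω
  filter_upwards [hω'] with x hx hxA
  by_contra hxB
  exact hx ⟨hxA, fun h ↦ hxB (by rwa [Set.mem_ofPred_eq, Fin.tail_cons] at h)⟩

lemma measurable_glue (s : Fin N → Bool) :
    Measurable fun p : (Fin N → Ω) × (Fin N → Ω) ↦ glue s p.1 p.2 := by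
  refine measurable_pi_iff.2 fun i ↦ ?_
  unfold glue
  cases s i
  · exact (measurable_pi_apply i).comp measurable_fst
  · exact (measurable_pi_apply i).comp measurable_snd

variable (μ) in
/-- The coordinate patterns `s` such that resampling the coordinates of `x` selected by `s` lands
in `A` with positive probability. Unlike its pointwise analogue `convUA A x`, this set depends
measurably on `x`. -/
def essPatterns (A : Set (Fin N → Ω)) (x : Fin N → Ω) : Set (Fin N → Bool) :=
  {s | piP μ N {y | glue s x y ∈ A} ≠ 0}

lemma measurable_essPatterns {A : Set (Fin N → Ω)} (hA : MeasurableSet A) :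
    Measurable (essPatterns μ A) := by
  refine measurable_set_iff.2 fun s ↦ ?_
  have h : Measurable fun x ↦ piP μ N {y | glue s x y ∈ A} :=
    measurable_measure_prodMk_left (measurable_glue s hA)
  exact measurableSet_setOfPred.1 (h (measurableSet_singleton 0)).compl

lemma measurable_hullDist_essPatterns {A : Set (Fin N → Ω)} (hA : MeasurableSet A) :
    Measurable fun x ↦ hullDist (essPatterns μ A x) :=
  (measurable_of_finite hullDist).comp (measurable_essPatterns hA)

lemma essPatterns_nonempty {A : Set (Fin N → Ω)} (hA : piP μ N A ≠ 0) (x : Fin N → Ω) :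
    (essPatterns μ A x).Nonempty :=
  ⟨fun _ ↦ true, hA⟩

lemma fConv_le_hullDist {A : Set (Fin N → Ω)} (hA : piP μ N A ≠ 0) (x : Fin N → Ω) :
    fConv A x ≤ hullDist (essPatterns μ A x) := by
  refine Metric.infDist_le_infDist_of_subset (convexHull_mono ?_)
    (((essPatterns_nonempty hA x).image _).convexHull)
  rintro _ ⟨s, hs, rfl⟩
  obtain ⟨y, hy⟩ := nonempty_of_measure_ne_zero hs
  refine ⟨fun i ↦ by cases h : s i <;> simp [cubeVertex, h], glue s x y, hy, fun i hi ↦ ?_⟩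
  cases h : s i
  · simp [glue, h]
  · simp [cubeVertex, h] at hi

lemma cons_false_mem_essPatterns {A : Set (Fin (N + 1) → Ω)} (hA : MeasurableSet A) (ω : Ω)
    (x : Fin N → Ω) (s : Fin N → Bool) (hs : s ∈ essPatterns μ {x | Fin.cons ω x ∈ A} x) :
    Fin.cons false s ∈ essPatterns μ A (Fin.cons ω x) := by
  have hm : MeasurableSet {y | glue (Fin.cons false s : Fin (N + 1) → Bool)
      (Fin.cons ω x) y ∈ A} := ((measurable_glue _).comp measurable_prodMk_left) hA
  rw [essPatterns, Set.mem_ofPred_eq, piP_succ_apply hm]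
  simpa [glue_cons_false, essPatterns] using hs

lemma cons_true_mem_essPatterns {A : Set (Fin (N + 1) → Ω)} (hA : MeasurableSet A) (ω : Ω)
    (x : Fin N → Ω) (s : Fin N → Bool) (hs : s ∈ essPatterns μ (essProj μ A) x) :
    Fin.cons true s ∈ essPatterns μ A (Fin.cons ω x) := by
  have hm : MeasurableSet {y | glue (Fin.cons true s : Fin (N + 1) → Bool)
      (Fin.cons ω x) y ∈ A} := ((measurable_glue _).comp measurable_prodMk_left) hA
  rw [essPatterns, Set.mem_ofPred_eq, piP_succ_apply_symm hm]
  intro h0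
  rw [lintegral_eq_zero_iff (measurable_measure_section hm)] at h0
  simp only [Set.mem_ofPred_eq, glue_cons_true] at h0
  refine hs (measure_mono_null (fun y hy ↦ ?_) (ae_iff.1 h0))
  exact hy

/-- The inductive step on a single section: Hölder's inequality combined with the best choice of
the interpolation parameter. -/
lemma lintegral_exp_hullDist_section_le {α : ℝ} (hα : 0 < α)
    (ih : ∀ A : Set (Fin N → Ω), MeasurableSet A → piP μ N A ≠ 0 →
      ∫⁻ x, ENNReal.ofReal (Real.exp (α / (2 * (α + 1)) * hullDist (essPatterns μ A x) ^ 2))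
        ∂(piP μ N) ≤ ENNReal.ofReal ((piP μ N).real A ^ (-α)))
    {A : Set (Fin (N + 1) → Ω)} (hA : MeasurableSet A) (hB : piP μ N (essProj μ A) ≠ 0) {ω : Ω}
    (hω : piP μ N {x | Fin.cons ω x ∈ A} ≤ piP μ N (essProj μ A)) :
    ∫⁻ x, ENNReal.ofReal (Real.exp
        (α / (2 * (α + 1)) * hullDist (essPatterns μ A (Fin.cons ω x)) ^ 2)) ∂(piP μ N) ≤
      ENNReal.ofReal ((piP μ N).real (essProj μ A) ^ (-α) *
        (1 + α - α * ((piP μ N).real {x | Fin.cons ω x ∈ A} / (piP μ N).real (essProj μ A)))) := by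
  set a : ℝ := α / (2 * (α + 1))
  have ha0 : 0 ≤ a := by positivity
  set C : Set (Fin N → Ω) := {x | Fin.cons ω x ∈ A}
  set B := essProj μ A
  have hCm : MeasurableSet C := measurableSet_section hA ω
  have hBm : MeasurableSet B := measurableSet_essProj hA
  have hq : 0 < (piP μ N).real B := ENNReal.toReal_pos hB (measure_ne_top _ _)
  have hp : 0 ≤ (piP μ N).real C := measureReal_nonneg
  have hpq : (piP μ N).real C ≤ (piP μ N).real B := ENNReal.toReal_mono (measure_ne_top _ _) hω
  obtain ⟨l, hl0, hl1, hlr, hl⟩ := exists_interpolation_parameter hα (div_le_one_of_le₀ hpq hq.le)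
  have hS : piP μ N C = 0 → l = 0 := fun h ↦ hlr (by simp [measureReal_def, h])
  set F : (Fin N → Ω) → ℝ≥0∞ := fun x ↦
    ENNReal.ofReal (Real.exp (a * hullDist (essPatterns μ C x) ^ 2)) with hF
  set G : (Fin N → Ω) → ℝ≥0∞ := fun x ↦
    ENNReal.ofReal (Real.exp (a * hullDist (essPatterns μ B x) ^ 2)) with hG
  have hFm : Measurable F :=
    (((measurable_hullDist_essPatterns hCm).pow_const 2).const_mul a).exp.ennreal_ofReal
  have hGm : Measurable G :=
    (((measurable_hullDist_essPatterns hBm).pow_const 2).const_mul a).exp.ennreal_ofReal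
  have hpoint (x : Fin N → Ω) :
      ENNReal.ofReal (Real.exp (a * hullDist (essPatterns μ A (Fin.cons ω x)) ^ 2)) ≤
        ENNReal.ofReal (Real.exp (a * (1 - l) ^ 2)) * (F x ^ l * G x ^ (1 - l)) := by
    have h := hullDist_sq_le (cons_false_mem_essPatterns hA ω x) (cons_true_mem_essPatterns hA ω x)
      (essPatterns_nonempty hB x) hl0 hl1 (by
        by_cases h : piP μ N C = 0
        · exact Or.inr (hS h)
        · exact Or.inl (essPatterns_nonempty h x))
    rw [hF, hG, ENNReal.ofReal_rpow_of_pos (Real.exp_pos _),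
      ENNReal.ofReal_rpow_of_pos (Real.exp_pos _), ← Real.exp_mul, ← Real.exp_mul,
      ← ENNReal.ofReal_mul (Real.exp_pos _).le, ← ENNReal.ofReal_mul (Real.exp_pos _).le,
      ← Real.exp_add, ← Real.exp_add]
    refine ENNReal.ofReal_le_ofReal (Real.exp_le_exp.2 ?_)
    linarith [mul_le_mul_of_nonneg_left h ha0]
  have hFl : (∫⁻ x, F x ∂(piP μ N)) ^ l ≤ ENNReal.ofReal ((piP μ N).real C ^ (-α * l)) := by
    by_cases h : piP μ N C = 0
    · simp [hS h]
    · have hp' : 0 < (piP μ N).real C := ENNReal.toReal_pos h (measure_ne_top _ _)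
      rw [Real.rpow_mul hp, ← ENNReal.ofReal_rpow_of_pos (Real.rpow_pos_of_pos hp' _)]
      exact ENNReal.rpow_le_rpow (ih C hCm h) hl0
  have hGl : (∫⁻ x, G x ∂(piP μ N)) ^ (1 - l) ≤
      ENNReal.ofReal ((piP μ N).real B ^ (-α * (1 - l))) := by
    rw [Real.rpow_mul hq.le, ← ENNReal.ofReal_rpow_of_pos (Real.rpow_pos_of_pos hq _)]
    exact ENNReal.rpow_le_rpow (ih B hBm hB) (sub_nonneg.2 hl1)
  calc
    _ ≤ ∫⁻ x, ENNReal.ofReal (Real.exp (a * (1 - l) ^ 2)) * (F x ^ l * G x ^ (1 - l))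
        ∂(piP μ N) := lintegral_mono hpoint
    _ = ENNReal.ofReal (Real.exp (a * (1 - l) ^ 2)) *
        ∫⁻ x, F x ^ l * G x ^ (1 - l) ∂(piP μ N) :=
      lintegral_const_mul' _ _ ENNReal.ofReal_ne_top
    _ ≤ ENNReal.ofReal (Real.exp (a * (1 - l) ^ 2)) *
        (ENNReal.ofReal ((piP μ N).real C ^ (-α * l)) *
          ENNReal.ofReal ((piP μ N).real B ^ (-α * (1 - l)))) := by
      gcongr
      exact (ENNReal.lintegral_mul_norm_pow_le hFm.aemeasurable hGm.aemeasurable hl0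
        (sub_nonneg.2 hl1) (by ring)).trans (mul_le_mul' hFl hGl)
    _ = ENNReal.ofReal ((piP μ N).real B ^ (-α) * (Real.exp (a * (1 - l) ^ 2) *
        ((piP μ N).real C / (piP μ N).real B) ^ (-α * l))) := by
      rw [← ENNReal.ofReal_mul (Real.rpow_nonneg hp _), ← ENNReal.ofReal_mul (Real.exp_pos _).le]
      congr 1
      have hne := (Real.rpow_pos_of_pos hq (-α * l)).ne'
      rw [Real.div_rpow hp hq.le,
        show (piP μ N).real B ^ (-α) =
          (piP μ N).real B ^ (-α * (1 - l)) * (piP μ N).real B ^ (-α * l) by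
          rw [← Real.rpow_add hq]; ring_nf]
      field_simp
    _ ≤ _ := ENNReal.ofReal_le_ofReal (by gcongr)

/-- The exponential moment estimate for the essential convex distance. -/
theorem lintegral_exp_hullDist_le {α : ℝ} (hα : 0 < α) {N : ℕ} {A : Set (Fin N → Ω)}
    (hA : MeasurableSet A) (hA0 : piP μ N A ≠ 0) :
    ∫⁻ x, ENNReal.ofReal (Real.exp (α / (2 * (α + 1)) * hullDist (essPatterns μ A x) ^ 2))
      ∂(piP μ N) ≤ ENNReal.ofReal ((piP μ N).real A ^ (-α)) := by
  induction N with
  | zero =>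
    have hD (S : Set (Fin 0 → Bool)) (hS : S.Nonempty) : hullDist S = 0 := by
      obtain ⟨z, -, hz⟩ := exists_norm_eq_hullDist hS
      rw [← hz, Subsingleton.elim z 0, norm_zero]
    have hp : 0 < (piP μ 0).real A := ENNReal.toReal_pos hA0 (measure_ne_top _ _)
    simp only [hD _ (essPatterns_nonempty hA0 _)]
    simpa using Real.one_le_rpow_of_pos_of_le_one_of_nonpos hp measureReal_le_one
      (neg_nonpos.2 hα.le)
  | succ N ih =>
    set B := essProj μ A
    have hle := ae_piP_section_le (μ := μ) hA
    have hB : piP μ N B ≠ 0 := by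
      intro h
      refine hA0 ?_
      rw [piP_succ_apply hA, lintegral_eq_zero_iff (measurable_piP_section hA)]
      filter_upwards [hle] with ω hω
      exact le_antisymm (hω.trans h.le) bot_le
    set q := (piP μ N).real B
    have hq : 0 < q := ENNReal.toReal_pos hB (measure_ne_top _ _)
    have hpA : 0 < (piP μ (N + 1)).real A := ENNReal.toReal_pos hA0 (measure_ne_top _ _)
    set p : Ω → ℝ := fun ω ↦ (piP μ N).real {x | Fin.cons ω x ∈ A}
    have hpm : Measurable p := (measurable_piP_section hA).ennreal_toReal
    have hpi : Integrable p μ := by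
      refine Integrable.of_bound hpm.aestronglyMeasurable 1 (ae_of_all _ fun ω ↦ ?_)
      rw [Real.norm_of_nonneg measureReal_nonneg]
      exact measureReal_le_one
    have hpint : ∫ ω, p ω ∂μ = (piP μ (N + 1)).real A := by
      rw [measureReal_def, piP_succ_apply hA]
      exact integral_toReal (measurable_piP_section hA).aemeasurable
        (ae_of_all _ fun ω ↦ measure_lt_top _ _)
    have hmeas : Measurable fun x ↦ ENNReal.ofReal (Real.exp
        (α / (2 * (α + 1)) * hullDist (essPatterns μ A x) ^ 2)) :=
      (((measurable_hullDist_essPatterns hA).pow_const 2).const_mul _).exp.ennreal_ofReal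
    have hfi : Integrable (fun ω ↦ q ^ (-α) * (1 + α - α * (p ω / q))) μ :=
      ((integrable_const _).sub ((hpi.div_const q).const_mul α)).const_mul _
    rw [← (measurePreserving_cons μ N).lintegral_comp hmeas,
      lintegral_prod _ (by exact (hmeas.comp measurable_fin_cons).aemeasurable)]
    calc
      _ ≤ ∫⁻ ω, ENNReal.ofReal (q ^ (-α) * (1 + α - α * (p ω / q))) ∂μ := by
        refine lintegral_mono_ae ?_
        filter_upwards [hle] with ω hω
        exact lintegral_exp_hullDist_section_le hα (fun A hA hA0 ↦ ih hA hA0) hA hB hω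
      _ = ENNReal.ofReal (∫ ω, q ^ (-α) * (1 + α - α * (p ω / q)) ∂μ) := by
        refine (ofReal_integral_eq_lintegral_ofReal hfi ?_).symm
        filter_upwards [hle] with ω hω
        have hpq : p ω ≤ q := ENNReal.toReal_mono (measure_ne_top _ _) hω
        have := mul_le_mul_of_nonneg_left (div_le_one_of_le₀ hpq hq.le) hα.le
        exact mul_nonneg (Real.rpow_nonneg hq.le _) (by linarith)
      _ ≤ _ := by
        refine ENNReal.ofReal_le_ofReal ?_
        rw [integral_const_mul, integral_sub (integrable_const _)
          ((hpi.div_const q).const_mul α), integral_const_mul, integral_div, hpint]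
        simp only [integral_const, probReal_univ, one_smul]
        have h := mul_le_mul_of_nonneg_left (one_add_sub_mul_le_rpow_neg hα (div_pos hpA hq))
          (Real.rpow_nonneg hq.le (-α))
        rwa [Real.div_rpow hpA.le hq.le, mul_div_cancel₀ _ (Real.rpow_pos_of_pos hq _).ne'] at h

/-- The tail estimate at a fixed value of the exponent. -/
lemma piP_lt_fConv_le {α : ℝ} (hα : 0 < α) {A : Set (Fin N → Ω)} (hA : MeasurableSet A)
    (hA0 : piP μ N A ≠ 0) {t : ℝ} (ht : 0 ≤ t) :
    piP μ N {x | t < fConv A x} ≤ ENNReal.ofReal (Real.exp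
      (α * Real.log (1 / (piP μ N A).toReal) - α / (2 * (α + 1)) * t ^ 2)) := by
  have hp : 0 < (piP μ N A).toReal := ENNReal.toReal_pos hA0 (measure_ne_top _ _)
  set a : ℝ := α / (2 * (α + 1))
  have ha0 : 0 ≤ a := by positivity
  have hmeas : Measurable fun x ↦ ENNReal.ofReal (Real.exp
      (a * hullDist (essPatterns μ A x) ^ 2)) :=
    (((measurable_hullDist_essPatterns hA).pow_const 2).const_mul _).exp.ennreal_ofReal
  have hsub : {x | t < fConv A x} ⊆ {x | ENNReal.ofReal (Real.exp (a * t ^ 2)) ≤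
      ENNReal.ofReal (Real.exp (a * hullDist (essPatterns μ A x) ^ 2))} := by
    intro x hx
    have hx' : t ≤ hullDist (essPatterns μ A x) := (le_of_lt hx).trans (fConv_le_hullDist hA0 x)
    refine ENNReal.ofReal_le_ofReal (Real.exp_le_exp.2 ?_)
    gcongr
  have hpos : ENNReal.ofReal (Real.exp (a * t ^ 2)) ≠ 0 :=
    (ENNReal.ofReal_pos.2 (Real.exp_pos _)).ne'
  refine (measure_mono hsub).trans ((meas_ge_le_lintegral_div hmeas.aemeasurable hpos
    ENNReal.ofReal_ne_top).trans ?_)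
  refine (ENNReal.div_le_div_right (lintegral_exp_hullDist_le hα hA hA0) _).trans ?_
  rw [← ENNReal.ofReal_div_of_pos (Real.exp_pos _), measureReal_def,
    Real.rpow_def_of_pos hp, ← Real.exp_sub, one_div, Real.log_inv]
  exact (congrArg _ (congrArg _ (by ring))).le

end Measure

/-- Corollary 4.2.5 of Talagrand: for `t ≥ √(2 log(1/P(A)))`, the inner probability of
`A^c_t = {x : f_c(A,x) ≤ t}` is at least `1 - exp(-(t - √(2 log(1/P(A))))²/2)`.
Since `P` is a probability, this is stated equivalently as the outer-probability bound
`P({x : f_c(A,x) > t}) ≤ exp(-(t - √(2 log(1/P(A))))²/2)` (in Mathlib, a measure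
applied to an arbitrary set is its outer-measure value). -/
theorem talagrand_stmt16 {Ω : Type*} [MeasurableSpace Ω] (μ : Measure Ω)
    [IsProbabilityMeasure μ] (N : ℕ) (hN : 1 ≤ N)
    (A : Set (Fin N → Ω)) (hA : MeasurableSet A) (hA0 : 0 < piP μ N A)
    (t : ℝ) (ht : Real.sqrt (2 * Real.log (1 / (piP μ N A).toReal)) ≤ t) :
    piP μ N {x | t < fConv A x} ≤
      ENNReal.ofReal (Real.exp
        (-(t - Real.sqrt (2 * Real.log (1 / (piP μ N A).toReal))) ^ 2 / 2)) := by
  have hA0' : piP μ N A ≠ 0 := hA0.ne'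
  have hp : 0 < (piP μ N A).toReal := ENNReal.toReal_pos hA0' (measure_ne_top _ _)
  have hp1 : (piP μ N A).toReal ≤ 1 := measureReal_le_one
  have hlog : 0 ≤ Real.log (1 / (piP μ N A).toReal) := Real.log_nonneg (one_le_one_div hp hp1)
  set u := Real.sqrt (2 * Real.log (1 / (piP μ N A).toReal))
  have hu0 : 0 ≤ u := Real.sqrt_nonneg _
  have hu2 : u ^ 2 = 2 * Real.log (1 / (piP μ N A).toReal) := Real.sq_sqrt (by positivity)
  have ht0 : 0 ≤ t := hu0.trans ht
  rcases ht.eq_or_lt with rfl | hut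
  · simpa using prob_le_one
  rcases hu0.eq_or_lt with hu0 | hu0
  · have hL : Real.log (1 / (piP μ N A).toReal) = 0 := by
      rw [← hu0] at hu2
      linarith
    have hlim : Filter.Tendsto (fun n : ℕ ↦ ENNReal.ofReal (Real.exp
        (-(t ^ 2 / 2 * ((n : ℝ) / ((n : ℝ) + 1)))))) Filter.atTop
        (nhds (ENNReal.ofReal (Real.exp (-(t ^ 2 / 2 * 1))))) :=
      ENNReal.tendsto_ofReal ((Real.continuous_exp.tendsto _).comp
        ((tendsto_natCast_div_add_atTop (1 : ℝ)).const_mul _).neg)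
    have he : -(t - u) ^ 2 / 2 = -(t ^ 2 / 2 * 1) := by
      rw [← hu0]
      ring
    rw [he]
    refine ge_of_tendsto hlim (Filter.eventually_atTop.2 ⟨1, fun n hn ↦ ?_⟩)
    have hn0 : (0 : ℝ) < n := by exact_mod_cast hn
    refine (piP_lt_fConv_le hn0 hA hA0' ht0).trans_eq ?_
    rw [hL]
    congr 2
    field_simp
    ring
  · have hα : 0 < t / u - 1 := by
      rw [sub_pos, one_lt_div hu0]
      exact hut
    refine (piP_lt_fConv_le hα hA hA0' ht0).trans_eq ?_
    rw [show Real.log (1 / (piP μ N A).toReal) = u ^ 2 / 2 by linarith]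
    have ht' : t ≠ 0 := (hu0.trans hut).ne'
    congr 2
    rw [sub_add_cancel]
    field_simp
    ring
end

section
/- Let $S_N$ be the group of permutations of $\{1,\dots,N\}$ with the uniform probability $P_N$. For $A \subseteq S_N$ nonempty and $\sigma \in S_N$, let $U_A(\sigma) = \{s \in \{0,1\}^N : \exists \tau \in A,\ \forall \ell \le N,\ s_\ell = 0 \Rightarrow \tau(\ell) = \sigma(\ell)\}$, let $V_A(\sigma) \subseteq [0,1]^N$ be the convex hull of $U_A(\sigma)$, and set $f(A,\sigma) = \inf\{\sum_{\ell \le N} s_\ell^2 : s \in V_A(\sigma)\}$. Then $\int_{S_N} \exp\big(\tfrac{1}{16} f(A,\sigma)\big)\, dP_N(\sigma) \le \frac{1}{P_N(A)}$. -/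
open MeasureTheory ENNReal

instance permMeasurableSpace (N : ℕ) : MeasurableSpace (Equiv.Perm (Fin N)) := ⊤

/-- The uniform (homogeneous) probability `P_N` on the symmetric group `S_N`. -/
noncomputable def permUniform (N : ℕ) : Measure (Equiv.Perm (Fin N)) :=
  (Fintype.card (Equiv.Perm (Fin N)) : ℝ≥0∞)⁻¹ • Measure.count

/-- `U_A(σ) = {s ∈ {0,1}^N : ∃ τ ∈ A, ∀ ℓ, s_ℓ = 0 → τ(ℓ) = σ(ℓ)} ⊆ ℝ^N`. -/
def permUA {N : ℕ} (A : Set (Equiv.Perm (Fin N))) (σ : Equiv.Perm (Fin N)) :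
    Set (Fin N → ℝ) :=
  {s | (∀ l, s l = 0 ∨ s l = 1) ∧ ∃ τ ∈ A, ∀ l, s l = 0 → τ l = σ l}

/-- `f(A,σ) = inf { ∑_ℓ s_ℓ² : s ∈ V_A(σ) }`, `V_A(σ)` the convex hull of `U_A(σ)`. -/
noncomputable def permF {N : ℕ} (A : Set (Equiv.Perm (Fin N)))
    (σ : Equiv.Perm (Fin N)) : ℝ :=
  ⨅ s : convexHull ℝ (permUA A σ), ∑ l, ((s : Fin N → ℝ) l) ^ 2

/-- The set of permutations which agree with `σ₀` outside `S`. -/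
def agreeOff {α : Type*} [Fintype α] [DecidableEq α] (S : Finset α) (σ₀ : Equiv.Perm α) :
    Finset (Equiv.Perm α) :=
  Finset.univ.filter fun σ => ∀ l, l ∉ S → σ l = σ₀ l

/-- `w` is a probability weight on the permutations carried by `A`. -/
structure IsProbWeight {α : Type*} [Fintype α] [DecidableEq α] (A : Finset (Equiv.Perm α))
    (w : Equiv.Perm α → ℝ) : Prop where
  nonneg : ∀ τ, 0 ≤ w τ
  eq_zero : ∀ τ, τ ∉ A → w τ = 0
  sum_eq_one : ∑ τ, w τ = 1

/-- The `w`-probability that a permutation disagrees with `σ` at `l`. -/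
def disagreement {α : Type*} [Fintype α] [DecidableEq α] (w : Equiv.Perm α → ℝ)
    (σ : Equiv.Perm α) (l : α) : ℝ :=
  ∑ τ, w τ * if τ l = σ l then 0 else 1

section Weights

variable {α : Type*} [Fintype α] [DecidableEq α]

lemma mem_agreeOff {S : Finset α} {σ₀ σ : Equiv.Perm α} :
    σ ∈ agreeOff S σ₀ ↔ ∀ l, l ∉ S → σ l = σ₀ l := by
  simp [agreeOff]

lemma IsProbWeight.mono {A B : Finset (Equiv.Perm α)} {w : Equiv.Perm α → ℝ}
    (h : IsProbWeight A w) (hAB : A ⊆ B) : IsProbWeight B w :=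
  ⟨h.nonneg, fun τ hτ => h.eq_zero τ fun hA => hτ (hAB hA), h.sum_eq_one⟩

lemma IsProbWeight.combine {A : Finset (Equiv.Perm α)} {v w : Equiv.Perm α → ℝ}
    (hv : IsProbWeight A v) (hw : IsProbWeight A w) {θ : ℝ} (h0 : 0 ≤ θ) (h1 : θ ≤ 1) :
    IsProbWeight A (fun τ => θ * v τ + (1 - θ) * w τ) where
  nonneg τ := add_nonneg (mul_nonneg h0 (hv.nonneg τ))
    (mul_nonneg (sub_nonneg.2 h1) (hw.nonneg τ))
  eq_zero τ hτ := by simp [hv.eq_zero τ hτ, hw.eq_zero τ hτ]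
  sum_eq_one := by
    rw [Finset.sum_add_distrib, ← Finset.mul_sum, ← Finset.mul_sum, hv.sum_eq_one, hw.sum_eq_one]
    ring

lemma isProbWeight_single {A : Finset (Equiv.Perm α)} {τ : Equiv.Perm α} (hτ : τ ∈ A) :
    IsProbWeight A (fun ρ => if ρ = τ then 1 else 0) where
  nonneg ρ := by positivity
  eq_zero ρ hρ := if_neg fun h => hρ (by rwa [h])
  sum_eq_one := by simp

lemma disagreement_combine (v w : Equiv.Perm α → ℝ) (θ : ℝ) (σ : Equiv.Perm α) (l : α) :
    disagreement (fun τ => θ * v τ + (1 - θ) * w τ) σ l =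
      θ * disagreement v σ l + (1 - θ) * disagreement w σ l := by
  simp only [disagreement, Finset.mul_sum, ← Finset.sum_add_distrib]
  exact Finset.sum_congr rfl fun τ _ => by ring

lemma disagreement_congr (w : Equiv.Perm α → ℝ) {σ σ' : Equiv.Perm α} {l : α} (h : σ l = σ' l) :
    disagreement w σ l = disagreement w σ' l := by
  simp only [disagreement, h]

lemma IsProbWeight.disagreement_nonneg {A : Finset (Equiv.Perm α)} {w : Equiv.Perm α → ℝ}
    (h : IsProbWeight A w) (σ : Equiv.Perm α) (l : α) : 0 ≤ disagreement w σ l :=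
  Finset.sum_nonneg fun τ _ => mul_nonneg (h.nonneg τ) (by positivity)

lemma IsProbWeight.disagreement_le_one {A : Finset (Equiv.Perm α)} {w : Equiv.Perm α → ℝ}
    (h : IsProbWeight A w) (σ : Equiv.Perm α) (l : α) : disagreement w σ l ≤ 1 := by
  rw [← h.sum_eq_one]
  refine Finset.sum_le_sum fun τ _ => mul_le_of_le_one_right (h.nonneg τ) ?_
  split_ifs <;> norm_num

lemma IsProbWeight.disagreement_eq_zero {A : Finset (Equiv.Perm α)} {w : Equiv.Perm α → ℝ}
    (h : IsProbWeight A w) {σ : Equiv.Perm α} {l : α} (hA : ∀ τ ∈ A, τ l = σ l) :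
    disagreement w σ l = 0 := by
  refine Finset.sum_eq_zero fun τ _ => ?_
  by_cases hτ : τ ∈ A
  · simp [hA τ hτ]
  · simp [h.eq_zero τ hτ]

lemma disagreement_inv (w : Equiv.Perm α → ℝ) (σ : Equiv.Perm α) (l : α) :
    disagreement (fun τ => w τ⁻¹) σ l = disagreement w σ⁻¹ (σ l) := by
  unfold disagreement
  refine Fintype.sum_equiv (Equiv.inv _) _ _ fun τ => ?_
  have : τ l = σ l ↔ τ⁻¹ (σ l) = σ⁻¹ (σ l) := by
    rw [Equiv.Perm.inv_eq_iff_eq, Equiv.Perm.coe_inv, Equiv.symm_apply_apply, eq_comm]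
  simp only [Equiv.inv_apply, this]

/-- Mixing a weight on permutations agreeing with `σ` at `p` with an arbitrary one, measured
against the modification `swap i j * σ`, costs at most a quadratic term. -/
lemma sum_sq_disagreement_combine_le {A B : Finset (Equiv.Perm α)} {v w : Equiv.Perm α → ℝ}
    {p i j : α} {σ : Equiv.Perm α} (hv : IsProbWeight A v) (hw : IsProbWeight B w)
    (hA : ∀ τ ∈ A, τ p = i) (hσ : σ p = i) {θ : ℝ} (h0 : 0 ≤ θ) (h1 : θ ≤ 1) :
    ∑ l, disagreement (fun τ => θ * v τ + (1 - θ) * w τ) σ l ^ 2 +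
        disagreement (fun τ => θ * v τ + (1 - θ) * w τ) σ p ^ 2 ≤
      θ * (∑ l, disagreement v σ l ^ 2 + disagreement v σ (σ⁻¹ j) ^ 2) +
        (1 - θ) * ∑ l, disagreement w (Equiv.swap i j * σ) l ^ 2 + 4 * (1 - θ) ^ 2 := by
  simp only [disagreement_combine]
  have hη : 0 ≤ 1 - θ := sub_nonneg.2 h1
  have hvp : disagreement v σ p = 0 := hv.disagreement_eq_zero fun τ hτ => (hA τ hτ).trans hσ.symm
  have hwp := hw.disagreement_nonneg σ p
  have hwp1 := hw.disagreement_le_one σ p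
  have hp : (θ * disagreement v σ p + (1 - θ) * disagreement w σ p) ^ 2 ≤ (1 - θ) ^ 2 := by
    rw [hvp, mul_zero, zero_add, mul_pow]
    exact mul_le_of_le_one_right (sq_nonneg _) (pow_le_one₀ hwp hwp1)
  have key : ∀ l, (θ * disagreement v σ l + (1 - θ) * disagreement w σ l) ^ 2 ≤
      θ * disagreement v σ l ^ 2 + (1 - θ) * disagreement w (Equiv.swap i j * σ) l ^ 2 +
        (if l = p then (1 - θ) ^ 2 else 0) +
        (if l = σ⁻¹ j then θ * disagreement v σ (σ⁻¹ j) ^ 2 + 2 * (1 - θ) ^ 2 else 0) := by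
    intro l
    have hx : 0 ≤ θ * disagreement v σ l ^ 2 := by positivity
    have hy : 0 ≤ (1 - θ) * disagreement w (Equiv.swap i j * σ) l ^ 2 := by positivity
    have hsq : (0 : ℝ) ≤ (1 - θ) ^ 2 := sq_nonneg _
    by_cases hlj : l = σ⁻¹ j
    · rw [if_pos hlj, ← hlj]
      have hz : (0 : ℝ) ≤ if l = p then (1 - θ) ^ 2 else 0 := by positivity
      have hw1 : ((1 - θ) * disagreement w σ l) ^ 2 ≤ (1 - θ) ^ 2 := by
        rw [mul_pow]
        exact mul_le_of_le_one_right hsq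
          (pow_le_one₀ (hw.disagreement_nonneg σ l) (hw.disagreement_le_one σ l))
      have hθ : (θ * disagreement v σ l) ^ 2 ≤ θ * disagreement v σ l ^ 2 := by
        rw [mul_pow]
        exact mul_le_mul_of_nonneg_right (by nlinarith) (sq_nonneg _)
      nlinarith [sq_nonneg (θ * disagreement v σ l - (1 - θ) * disagreement w σ l)]
    · rw [if_neg hlj]
      by_cases hlp : l = p
      · rw [if_pos hlp]
        subst hlp
        linarith
      · rw [if_neg hlp]
        have hl : σ l = (Equiv.swap i j * σ) l := by
          rw [Equiv.Perm.mul_apply, Equiv.swap_apply_of_ne_of_ne]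
          · exact fun h => hlp (σ.injective (h.trans hσ.symm))
          · exact fun h => hlj (by rw [← h, Equiv.Perm.coe_inv, Equiv.symm_apply_apply])
        rw [disagreement_congr w hl]
        nlinarith [mul_nonneg (mul_nonneg h0 hη)
          (sq_nonneg (disagreement v σ l - disagreement w (Equiv.swap i j * σ) l))]
  have hsum := Finset.sum_le_sum fun l (_ : l ∈ Finset.univ) => key l
  simp only [Finset.sum_add_distrib, ← Finset.mul_sum, Finset.sum_ite_eq', Finset.mem_univ,
    if_true] at hsum
  linarith

end Weights

lemma Real.exp_neg_le_quadratic {t : ℝ} (ht : 0 ≤ t) : Real.exp (-t) ≤ 1 - t + t ^ 2 / 2 := by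
  have h := Real.quadratic_le_exp_of_nonneg ht
  rw [Real.exp_neg, inv_le_iff_one_le_mul₀ (Real.exp_pos t)]
  nlinarith [mul_le_mul_of_nonneg_left h (by nlinarith [sq_nonneg (t - 1)] :
    (0 : ℝ) ≤ 1 - t + t ^ 2 / 2), sq_nonneg (t ^ 2)]

lemma Real.exp_le_cubic {u : ℝ} (h0 : 0 ≤ u) (h1 : u ≤ 1) :
    Real.exp u ≤ 1 + u + u ^ 2 / 2 + 2 / 9 * u ^ 3 := by
  have h := Real.exp_bound' h0 h1 (n := 3) (by norm_num)
  norm_num [Finset.sum_range_succ, Nat.factorial] at h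
  linarith

lemma exists_exp_sq_sub_log_le {r : ℝ} (h0 : 0 < r) (h1 : r ≤ 1) :
    ∃ θ : ℝ, 0 ≤ θ ∧ θ ≤ 1 ∧ Real.exp ((1 - θ) ^ 2 / 4 - θ * Real.log r) ≤ 2 - r := by
  obtain ⟨t, rfl⟩ : ∃ t, r = Real.exp (-t) := ⟨-Real.log r, by rw [neg_neg, Real.exp_log h0]⟩
  have ht : 0 ≤ t := by
    rw [Real.exp_le_one_iff] at h1
    linarith
  simp only [Real.log_exp]
  rcases le_total t (1 / 2) with h | h
  · refine ⟨1 - 2 * t, by linarith, by linarith, ?_⟩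
    have e1 := Real.exp_neg_le_quadratic ht
    have e2 := Real.exp_le_cubic (u := t - t ^ 2) (by nlinarith) (by nlinarith)
    have e3 : (1 - (1 - 2 * t)) ^ 2 / 4 - (1 - 2 * t) * -t = t - t ^ 2 := by ring
    rw [e3]
    have e4 : 0 ≤ t ^ 3 * (1 - t / 2 - 2 / 9 * (1 - t) ^ 3) := by
      have : (1 - t) ^ 3 ≤ 1 := pow_le_one₀ (by linarith) (by linarith)
      exact mul_nonneg (by positivity) (by linarith)
    nlinarith
  · refine ⟨0, le_rfl, zero_le_one, ?_⟩
    have e1 := Real.exp_neg_le_quadratic (t := 1 / 2) (by norm_num)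
    have e2 := Real.exp_le_cubic (u := 1 / 4) (by norm_num) (by norm_num)
    have e3 : Real.exp (-t) ≤ Real.exp (-(1 / 2)) := Real.exp_le_exp.2 (by linarith)
    norm_num at e1 e2 ⊢
    linarith

/-- Hölder's inequality for sums of exponentials. -/
lemma sum_exp_combine_le {ι : Type*} {s : Finset ι} {a b : ι → ℝ} {P Q θ : ℝ} (hP : 0 < P)
    (hQ : 0 < Q) (h0 : 0 ≤ θ) (h1 : θ ≤ 1) (ha : ∑ i ∈ s, Real.exp (a i) ≤ P)
    (hb : ∑ i ∈ s, Real.exp (b i) ≤ Q) :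
    ∑ i ∈ s, Real.exp (θ * a i + (1 - θ) * b i) ≤
      Real.exp (θ * Real.log P + (1 - θ) * Real.log Q) := by
  have hη : 0 ≤ 1 - θ := sub_nonneg.2 h1
  have key : ∀ i ∈ s, Real.exp (θ * a i + (1 - θ) * b i) ≤
      Real.exp (θ * Real.log P + (1 - θ) * Real.log Q) *
        (θ * (Real.exp (a i) / P) + (1 - θ) * (Real.exp (b i) / Q)) := by
    intro i _
    have h := convexOn_exp.2 (Set.mem_univ (a i - Real.log P)) (Set.mem_univ (b i - Real.log Q))
      h0 hη (by ring)
    simp only [smul_eq_mul, Real.exp_sub, Real.exp_log hP, Real.exp_log hQ] at h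
    refine le_trans (le_of_eq ?_) (mul_le_mul_of_nonneg_left h (Real.exp_pos _).le)
    rw [← Real.exp_add]
    congr 1
    ring
  refine (Finset.sum_le_sum key).trans ?_
  rw [← Finset.mul_sum, Finset.sum_add_distrib, ← Finset.mul_sum, ← Finset.mul_sum,
    ← Finset.sum_div, ← Finset.sum_div]
  refine mul_le_of_le_one_right (Real.exp_pos _).le ?_
  have := mul_le_mul_of_nonneg_left ((div_le_one hP).2 ha) h0
  have := mul_le_mul_of_nonneg_left ((div_le_one hQ).2 hb) hη
  linarith

section Induction

variable {α : Type*} [Fintype α] [DecidableEq α]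

lemma agreeOff_erase_swap {S : Finset α} {σ₀ : Equiv.Perm α} {p i : α} (hp : p ∈ S)
    (hi : i ∈ S.image σ₀) :
    agreeOff (S.erase p) (Equiv.swap i (σ₀ p) * σ₀) =
      (agreeOff S σ₀).filter fun σ => σ p = i := by
  obtain ⟨k, hk, rfl⟩ := Finset.mem_image.1 hi
  have hoff : ∀ l, l ∉ S → (Equiv.swap (σ₀ k) (σ₀ p) * σ₀) l = σ₀ l := by
    intro l hl
    refine Equiv.swap_apply_of_ne_of_ne (fun h => hl ?_) fun h => hl ?_
    · rwa [σ₀.injective h]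
    · rwa [σ₀.injective h]
  ext σ
  simp only [Finset.mem_filter, mem_agreeOff, Finset.mem_erase, not_and]
  constructor
  · intro h
    refine ⟨fun l hl => (h l fun _ => hl).trans (hoff l hl), ?_⟩
    simpa using h p fun h => (h rfl).elim
  · rintro ⟨h, hσ⟩ l hl
    by_cases hlp : l = p
    · subst hlp
      simpa using hσ
    · exact (h l (hl hlp)).trans (hoff l (hl hlp)).symm

lemma apply_mem_image_of_mem_agreeOff {S : Finset α} {σ₀ σ : Equiv.Perm α} {p : α} (hp : p ∈ S)
    (hσ : σ ∈ agreeOff S σ₀) : σ p ∈ S.image σ₀ := by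
  by_contra h
  have hl : σ₀⁻¹ (σ p) ∉ S := fun hl => h (Finset.mem_image.2 ⟨_, hl, by simp⟩)
  have := mem_agreeOff.1 hσ _ hl
  rw [Equiv.Perm.coe_inv, Equiv.apply_symm_apply] at this
  exact hl (by rwa [Equiv.Perm.coe_inv, σ.injective this])

lemma swap_mul_mem_agreeOff {S : Finset α} {σ₀ σ : Equiv.Perm α} {i j : α}
    (hi : i ∈ S.image σ₀) (hj : j ∈ S.image σ₀) (hσ : σ ∈ agreeOff S σ₀) :
    Equiv.swap i j * σ ∈ agreeOff S σ₀ := by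
  refine mem_agreeOff.2 fun l hl => ?_
  have hne : ∀ k ∈ S.image σ₀, σ₀ l ≠ k := by
    rintro k hk rfl
    obtain ⟨m, hm, h⟩ := Finset.mem_image.1 hk
    exact hl (by rwa [← σ₀.injective h])
  rw [Equiv.Perm.mul_apply, mem_agreeOff.1 hσ l hl,
    Equiv.swap_apply_of_ne_of_ne (hne i hi) (hne j hj)]

/-- The exponential bound, with the disagreement at the point `p` counted twice, for sets of
permutations which are prescribed outside `n` points. -/
def ExpBound (α : Type*) [Fintype α] [DecidableEq α] (n : ℕ) : Prop :=
  ∀ (S : Finset α) (σ₀ : Equiv.Perm α) (A : Finset (Equiv.Perm α)) (p : α), S.card = n →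
    A ⊆ agreeOff S σ₀ → A.Nonempty →
    ∃ W : Equiv.Perm α → Equiv.Perm α → ℝ, (∀ σ ∈ agreeOff S σ₀, IsProbWeight A (W σ)) ∧
      ∑ σ ∈ agreeOff S σ₀,
          Real.exp ((∑ l, disagreement (W σ) σ l ^ 2 + disagreement (W σ) σ p ^ 2) / 16) ≤
        (n.factorial : ℝ) ^ 2 / A.card

lemma ExpBound.inv {n : ℕ} (H : ExpBound α n) {S : Finset α} {σ₀ : Equiv.Perm α}
    {A : Finset (Equiv.Perm α)} (q : α) (hS : S.card = n) (hAS : A ⊆ agreeOff S σ₀)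
    (hA : A.Nonempty) :
    ∃ W : Equiv.Perm α → Equiv.Perm α → ℝ, (∀ σ ∈ agreeOff S σ₀, IsProbWeight A (W σ)) ∧
      ∑ σ ∈ agreeOff S σ₀,
          Real.exp ((∑ l, disagreement (W σ) σ l ^ 2 +
            disagreement (W σ) σ (σ⁻¹ q) ^ 2) / 16) ≤
        (n.factorial : ℝ) ^ 2 / A.card := by
  have hK : ∀ σ, σ⁻¹ ∈ agreeOff (S.image σ₀) σ₀⁻¹ ↔ σ ∈ agreeOff S σ₀ := by
    intro σ
    simp only [mem_agreeOff]
    constructor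
    · intro h l hl
      have := h (σ₀ l) fun h' => hl (by simpa using h')
      rw [Equiv.Perm.coe_inv σ₀, Equiv.symm_apply_apply, Equiv.Perm.inv_eq_iff_eq] at this
      exact this.symm
    · intro h l hl
      have := h (σ₀⁻¹ l) fun h' => hl (Finset.mem_image.2 ⟨_, h', by simp⟩)
      rw [Equiv.Perm.coe_inv, Equiv.apply_symm_apply] at this
      rw [Equiv.Perm.inv_eq_iff_eq, Equiv.Perm.coe_inv, this]
  obtain ⟨W, hW, hsum⟩ := H (S.image σ₀) σ₀⁻¹ (A.map (Equiv.inv _).toEmbedding) q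
    (by rw [Finset.card_image_of_injective _ σ₀.injective, hS])
    (fun τ hτ => by
      obtain ⟨ρ, hρ, rfl⟩ := Finset.mem_map.1 hτ
      exact (hK ρ).2 (hAS hρ))
    (by simpa using hA)
  refine ⟨fun σ τ => W σ⁻¹ τ⁻¹, fun σ hσ => ?_, ?_⟩
  · have h := hW σ⁻¹ ((hK σ).2 hσ)
    refine ⟨fun τ => h.nonneg _, fun τ hτ => h.eq_zero _ (by simpa using hτ), ?_⟩
    rw [← h.sum_eq_one]
    exact Fintype.sum_equiv (Equiv.inv _) _ _ fun τ => rfl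
  · rw [Finset.card_map] at hsum
    refine le_trans (le_of_eq ?_) hsum
    refine Finset.sum_equiv (Equiv.inv _) (fun σ => (hK σ).symm) fun σ _ => ?_
    simp only [disagreement_inv, Equiv.Perm.coe_inv, Equiv.apply_symm_apply, Equiv.inv_apply]
    rw [Equiv.sum_comp σ (fun l => disagreement (W σ⁻¹) σ⁻¹ l ^ 2)]

lemma ExpBound.unweighted [Nonempty α] {n : ℕ} (H : ExpBound α n) {S : Finset α}
    {σ₀ : Equiv.Perm α} {A : Finset (Equiv.Perm α)} (hS : S.card = n)
    (hAS : A ⊆ agreeOff S σ₀) (hA : A.Nonempty) :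
    ∃ W : Equiv.Perm α → Equiv.Perm α → ℝ, (∀ σ ∈ agreeOff S σ₀, IsProbWeight A (W σ)) ∧
      ∑ σ ∈ agreeOff S σ₀, Real.exp ((∑ l, disagreement (W σ) σ l ^ 2) / 16) ≤
        (n.factorial : ℝ) ^ 2 / A.card := by
  obtain ⟨W, hW, h⟩ := H S σ₀ A (Classical.arbitrary α) hS hAS hA
  refine ⟨W, hW, le_trans (Finset.sum_le_sum fun σ _ => Real.exp_le_exp.2 ?_) h⟩
  gcongr
  exact le_add_of_nonneg_right (sq_nonneg _)

lemma expBound_zero : ExpBound α 0 := by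
  intro S σ₀ A p hS hAS hA
  obtain rfl := Finset.card_eq_zero.1 hS
  have hK : agreeOff ∅ σ₀ = {σ₀} := by
    ext σ
    simp [mem_agreeOff, Equiv.ext_iff]
  rw [hK] at hAS ⊢
  obtain rfl := hA.subset_singleton_iff.1 hAS
  have hW := isProbWeight_single (Finset.mem_singleton_self σ₀)
  have hd : ∀ l, disagreement (fun ρ => if ρ = σ₀ then 1 else 0) σ₀ l = 0 := fun l =>
    hW.disagreement_eq_zero fun τ hτ => by rw [Finset.mem_singleton.1 hτ]
  exact ⟨fun _ ρ => if ρ = σ₀ then 1 else 0, fun _ _ => hW, by simp [hd]⟩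

/-- The bound over the permutations mapping `p` to `i`, in terms of the fibre over `j`. -/
lemma ExpBound.fiber [Nonempty α] {n : ℕ} (H : ExpBound α n) {S : Finset α} {σ₀ : Equiv.Perm α}
    {A : Finset (Equiv.Perm α)} {p i j : α} (hp : p ∈ S) (hS : S.card = n + 1)
    (hAS : A ⊆ agreeOff S σ₀) (hi : i ∈ S.image σ₀) (hj : j ∈ S.image σ₀)
    (hAj : (A.filter fun τ => τ p = j).Nonempty)
    (hij : (A.filter fun τ => τ p = i).card ≤ (A.filter fun τ => τ p = j).card) :
    ∃ W : Equiv.Perm α → Equiv.Perm α → ℝ,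
      (∀ σ ∈ (agreeOff S σ₀).filter fun σ => σ p = i, IsProbWeight A (W σ)) ∧
      ∑ σ ∈ (agreeOff S σ₀).filter (fun σ => σ p = i),
          Real.exp ((∑ l, disagreement (W σ) σ l ^ 2 + disagreement (W σ) σ p ^ 2) / 16) ≤
        (n.factorial : ℝ) ^ 2 / (A.filter fun τ => τ p = j).card *
          (2 - (A.filter fun τ => τ p = i).card / (A.filter fun τ => τ p = j).card) := by
  have hT : (S.erase p).card = n := by rw [Finset.card_erase_of_mem hp, hS, Nat.add_sub_cancel]
  have hsub : ∀ k, (A.filter fun τ => τ p = k) ⊆ (agreeOff S σ₀).filter fun σ => σ p = k :=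
    fun k => Finset.filter_subset_filter _ hAS
  have hM : (0 : ℝ) < (A.filter fun τ => τ p = j).card := by exact_mod_cast hAj.card_pos
  have hn : (0 : ℝ) < (n.factorial : ℝ) ^ 2 := by positivity
  obtain ⟨V, hV, hVsum⟩ := H.unweighted hT
    ((hsub j).trans (agreeOff_erase_swap hp hj).symm.subset) hAj
  rw [agreeOff_erase_swap hp hj] at hV hVsum
  set M : ℝ := ((A.filter fun τ => τ p = j).card : ℝ)
  have hQ : 0 < (n.factorial : ℝ) ^ 2 / M := by positivity
  by_cases hijeq : i = j
  · subst hijeq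
    refine ⟨V, fun σ hσ => (hV σ hσ).mono (Finset.filter_subset _ _), ?_⟩
    rw [div_self hM.ne']
    norm_num only [mul_one]
    refine le_trans (Finset.sum_le_sum fun σ hσ => ?_) hVsum
    rw [(hV σ hσ).disagreement_eq_zero (l := p) fun τ hτ =>
      (Finset.mem_filter.1 hτ).2.trans (Finset.mem_filter.1 hσ).2.symm]
    simp
  have hswap : ∀ σ ∈ (agreeOff S σ₀).filter (fun σ => σ p = i),
      Equiv.swap i j * σ ∈ (agreeOff S σ₀).filter fun σ => σ p = j := by
    intro σ hσ
    obtain ⟨h1, h2⟩ := Finset.mem_filter.1 hσ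
    refine Finset.mem_filter.2 ⟨swap_mul_mem_agreeOff hi hj h1, ?_⟩
    rw [Equiv.Perm.mul_apply, h2, Equiv.swap_apply_left]
  have hVsum' : ∑ σ ∈ (agreeOff S σ₀).filter (fun σ => σ p = i), Real.exp
      ((∑ l, disagreement (V (Equiv.swap i j * σ)) (Equiv.swap i j * σ) l ^ 2) / 16) ≤
        (n.factorial : ℝ) ^ 2 / M := by
    refine le_trans ?_ hVsum
    rw [← Finset.sum_image (f := fun σ => Real.exp ((∑ l, disagreement (V σ) σ l ^ 2) / 16))
      (g := fun σ => Equiv.swap i j * σ) (fun a _ b _ h => mul_left_cancel h)]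
    refine Finset.sum_le_sum_of_subset_of_nonneg ?_ fun _ _ _ => (Real.exp_pos _).le
    exact Finset.image_subset_iff.2 hswap
  rcases (A.filter fun τ => τ p = i).eq_empty_or_nonempty with hAi | hAi
  · refine ⟨fun σ => V (Equiv.swap i j * σ),
      fun σ hσ => (hV _ (hswap σ hσ)).mono (Finset.filter_subset _ _), ?_⟩
    have hb : ∀ σ ∈ (agreeOff S σ₀).filter (fun σ => σ p = i),
        Real.exp ((∑ l, disagreement (V (Equiv.swap i j * σ)) σ l ^ 2 +
          disagreement (V (Equiv.swap i j * σ)) σ p ^ 2) / 16) ≤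
        2 * Real.exp
          ((∑ l, disagreement (V (Equiv.swap i j * σ)) (Equiv.swap i j * σ) l ^ 2) / 16) := by
      intro σ hσ
      have hc := sum_sq_disagreement_combine_le (p := p) (i := i) (j := j) (σ := σ)
        (isProbWeight_single (Finset.mem_singleton_self σ)) (hV _ (hswap σ hσ))
        (fun τ hτ => by rw [Finset.mem_singleton.1 hτ, (Finset.mem_filter.1 hσ).2])
        (Finset.mem_filter.1 hσ).2 le_rfl zero_le_one
      simp only [zero_mul, zero_add, sub_zero, one_mul] at hc
      have e2 := Real.exp_le_cubic (u := 1 / 4) (by norm_num) (by norm_num)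
      have e3 : Real.exp (1 / 4) ≤ 2 := e2.trans (by norm_num)
      refine le_trans ?_ (mul_le_mul_of_nonneg_right e3 (Real.exp_pos _).le)
      rw [← Real.exp_add]
      exact Real.exp_le_exp.2 (by linarith)
    refine (Finset.sum_le_sum hb).trans ?_
    rw [← Finset.mul_sum, hAi]
    simp only [Finset.card_empty, Nat.cast_zero, zero_div, sub_zero]
    linarith
  · have ha : (0 : ℝ) < (A.filter fun τ => τ p = i).card := by exact_mod_cast hAi.card_pos
    have haM : ((A.filter fun τ => τ p = i).card : ℝ) ≤ M := Nat.cast_le.2 hij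
    obtain ⟨X, hX, hXsum⟩ := H.inv j hT
      ((hsub i).trans (agreeOff_erase_swap hp hi).symm.subset) hAi
    rw [agreeOff_erase_swap hp hi] at hX hXsum
    set a : ℝ := ((A.filter fun τ => τ p = i).card : ℝ)
    obtain ⟨θ, h0, h1, hθ⟩ := exists_exp_sq_sub_log_le (div_pos ha hM) ((div_le_one hM).2 haM)
    refine ⟨fun σ τ => θ * X σ τ + (1 - θ) * V (Equiv.swap i j * σ) τ, fun σ hσ =>
      ((hX σ hσ).mono (Finset.filter_subset _ _)).combine
        ((hV _ (hswap σ hσ)).mono (Finset.filter_subset _ _)) h0 h1, ?_⟩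
    have hP : 0 < (n.factorial : ℝ) ^ 2 / a := by positivity
    have hHolder := mul_le_mul_of_nonneg_left (sum_exp_combine_le hP hQ h0 h1 hXsum hVsum')
      (Real.exp_pos ((1 - θ) ^ 2 / 4)).le
    rw [Finset.mul_sum] at hHolder
    have hlog : Real.log ((n.factorial : ℝ) ^ 2 / a) =
        Real.log ((n.factorial : ℝ) ^ 2 / M) - Real.log (a / M) := by
      rw [← Real.log_div hQ.ne' (div_pos ha hM).ne']
      congr 1
      field_simp
    refine (Finset.sum_le_sum fun σ hσ => ?_).trans (hHolder.trans ?_)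
    · have hc := sum_sq_disagreement_combine_le (p := p) (i := i) (j := j) (σ := σ)
        (hX σ hσ) (hV _ (hswap σ hσ)) (fun τ hτ => (Finset.mem_filter.1 hτ).2)
        (Finset.mem_filter.1 hσ).2 h0 h1
      rw [← Real.exp_add]
      exact Real.exp_le_exp.2 (by linarith)
    · rw [← Real.exp_add, hlog]
      refine le_trans (le_of_eq ?_) (mul_le_mul_of_nonneg_left hθ hQ.le)
      nth_rewrite 3 [← Real.exp_log hQ]
      rw [← Real.exp_add]
      congr 1
      ring

lemma ExpBound.succ {n : ℕ} (H : ExpBound α n) : ExpBound α (n + 1) := by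
  intro S σ₀ A p hS hAS hA
  wlog hp : p ∈ S generalizing p
  · obtain ⟨q, hq⟩ := Finset.card_pos.1 (hS.symm ▸ n.succ_pos : 0 < S.card)
    obtain ⟨W, hW, h⟩ := this q hq
    refine ⟨W, hW, le_trans (Finset.sum_le_sum fun σ hσ => Real.exp_le_exp.2 ?_) h⟩
    rw [(hW σ hσ).disagreement_eq_zero (l := p) fun τ hτ => by
      rw [mem_agreeOff.1 (hAS hτ) p hp, mem_agreeOff.1 hσ p hp]]
    gcongr
    exact (hW σ hσ).disagreement_nonneg σ q
  have : Nonempty α := ⟨p⟩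
  have hmaps : ∀ σ ∈ agreeOff S σ₀, σ p ∈ S.image σ₀ := fun σ hσ =>
    apply_mem_image_of_mem_agreeOff hp hσ
  obtain ⟨j, hj, hmax⟩ := Finset.exists_max_image (S.image σ₀)
    (fun i => (A.filter fun τ => τ p = i).card) ⟨_, Finset.mem_image_of_mem _ hp⟩
  have hAj : (A.filter fun τ => τ p = j).Nonempty := by
    obtain ⟨τ, hτ⟩ := hA
    refine Finset.card_pos.1 (lt_of_lt_of_le ?_ (hmax (τ p) (hmaps τ (hAS hτ))))
    exact Finset.card_pos.2 ⟨τ, Finset.mem_filter.2 ⟨hτ, rfl⟩⟩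
  choose! W hW hWsum using fun i (hi : i ∈ S.image σ₀) =>
    H.fiber hp hS hAS hi hj hAj (hmax i hi)
  refine ⟨fun σ => W (σ p) σ, fun σ hσ =>
    hW _ (hmaps σ hσ) σ (Finset.mem_filter.2 ⟨hσ, rfl⟩), ?_⟩
  rw [← Finset.sum_fiberwise_of_maps_to hmaps]
  have hM : (0 : ℝ) < (A.filter fun τ => τ p = j).card := by exact_mod_cast hAj.card_pos
  have hc : (0 : ℝ) < A.card := by exact_mod_cast hA.card_pos
  have hcard : (A.card : ℝ) = ∑ i ∈ S.image σ₀, ((A.filter fun τ => τ p = i).card : ℝ) := by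
    rw [Finset.card_eq_sum_card_fiberwise fun τ hτ => hmaps τ (hAS hτ), Nat.cast_sum]
  refine (Finset.sum_le_sum (g := fun i =>
    (n.factorial : ℝ) ^ 2 / (A.filter fun τ => τ p = j).card *
      (2 - (A.filter fun τ => τ p = i).card / (A.filter fun τ => τ p = j).card))
    fun i hi => ?_).trans ?_
  · refine le_trans (le_of_eq (Finset.sum_congr rfl fun σ hσ => ?_)) (hWsum i hi)
    beta_reduce
    rw [(Finset.mem_filter.1 hσ).2]
  rw [← Finset.mul_sum, Finset.sum_sub_distrib, ← Finset.sum_div, ← hcard, Finset.sum_const,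
    Finset.card_image_of_injective _ σ₀.injective, hS, Nat.factorial_succ, nsmul_eq_mul]
  push_cast
  rw [div_mul_eq_mul_div, div_le_div_iff₀ hM hc, mul_pow]
  set M : ℝ := ((A.filter fun τ => τ p = j).card : ℝ)
  have hR : (A.card : ℝ) = A.card / M * M := by field_simp
  have key : (((n : ℝ) + 1) * 2 - A.card / M) * A.card ≤ ((n : ℝ) + 1) ^ 2 * M := by
    generalize (A.card : ℝ) / M = R at hR ⊢
    rw [hR, ← mul_assoc]
    exact mul_le_mul_of_nonneg_right (by nlinarith [sq_nonneg ((n : ℝ) + 1 - R)]) hM.le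
  nlinarith [mul_le_mul_of_nonneg_left key (sq_nonneg (n.factorial : ℝ))]

lemma expBound (n : ℕ) : ExpBound α n := by
  induction n with
  | zero => exact expBound_zero
  | succ n ih => exact ih.succ

end Induction

lemma permF_le_sum_sq_disagreement {N : ℕ} {A : Set (Equiv.Perm (Fin N))}
    {B : Finset (Equiv.Perm (Fin N))} (hBA : ∀ τ ∈ B, τ ∈ A) {w : Equiv.Perm (Fin N) → ℝ}
    (hw : IsProbWeight B w) (σ : Equiv.Perm (Fin N)) :
    permF A σ ≤ ∑ l, disagreement w σ l ^ 2 := by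
  have hmem : disagreement w σ ∈ convexHull ℝ (permUA A σ) := by
    have hsupp : ∑ τ ∈ B, w τ = 1 := by
      rw [← hw.sum_eq_one]
      exact Finset.sum_subset (Finset.subset_univ _) fun τ _ hτ => hw.eq_zero τ hτ
    have h := (convex_convexHull ℝ (permUA A σ)).sum_mem (t := B) (w := w)
      (z := fun τ l => if τ l = σ l then 0 else 1) (fun τ _ => hw.nonneg τ) hsupp
      fun τ hτ => subset_convexHull ℝ _ ⟨fun l => by
        by_cases h : τ l = σ l <;> simp [h], τ, hBA τ hτ, fun l hl => by
          by_contra h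
          simp [h] at hl⟩
    convert h using 1
    ext l
    rw [Finset.sum_apply]
    exact (Finset.sum_subset (Finset.subset_univ _) fun τ _ hτ => by
      simp [hw.eq_zero τ hτ]).symm
  refine ciInf_le (f := fun s : convexHull ℝ (permUA A σ) => ∑ l, ((s : Fin N → ℝ) l) ^ 2)
    ⟨0, ?_⟩ ⟨disagreement w σ, hmem⟩
  rintro _ ⟨s, rfl⟩
  exact Finset.sum_nonneg fun l _ => sq_nonneg _

lemma sum_exp_permF_le {N : ℕ} (A : Finset (Equiv.Perm (Fin N))) (hA : A.Nonempty) :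
    ∑ σ, Real.exp (permF (A : Set (Equiv.Perm (Fin N))) σ / 16) ≤
      (N.factorial : ℝ) ^ 2 / A.card := by
  have hK : agreeOff Finset.univ (1 : Equiv.Perm (Fin N)) = Finset.univ := by
    ext σ
    simp [mem_agreeOff]
  have hAK : A ⊆ agreeOff Finset.univ (1 : Equiv.Perm (Fin N)) := hK ▸ Finset.subset_univ A
  obtain ⟨W, hW, h⟩ : ∃ W : Equiv.Perm (Fin N) → Equiv.Perm (Fin N) → ℝ,
      (∀ σ, IsProbWeight A (W σ)) ∧
      ∑ σ, Real.exp ((∑ l, disagreement (W σ) σ l ^ 2) / 16) ≤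
        (N.factorial : ℝ) ^ 2 / A.card := by
    rcases isEmpty_or_nonempty (Fin N) with hN | hN
    · obtain rfl : N = 0 := Nat.eq_zero_of_not_pos fun h => hN.false ⟨0, h⟩
      obtain ⟨τ, hτ⟩ := hA
      have hcard : A.card = 1 :=
        le_antisymm (A.card_le_univ.trans (by simp)) (Finset.card_pos.2 ⟨τ, hτ⟩)
      exact ⟨fun _ ρ => if ρ = τ then 1 else 0, fun _ => isProbWeight_single hτ, by simp [hcard]⟩
    · have := (expBound N).unweighted (by simp) hAK hA
      rw [hK] at this
      simpa using this
  refine (Finset.sum_le_sum fun σ _ => Real.exp_le_exp.2 ?_).trans h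
  gcongr
  exact permF_le_sum_sq_disagreement (fun τ hτ => hτ) (hW σ) σ

/-- Theorem 5.1 of Talagrand: for every nonempty `A ⊆ S_N`,
`∫ exp(f(A,σ)/16) dP_N(σ) ≤ 1/P_N(A)`. -/
theorem talagrand_stmt18 (N : ℕ) (A : Set (Equiv.Perm (Fin N))) (hA : A.Nonempty) :
    ∫⁻ σ, ENNReal.ofReal (Real.exp (permF A σ / 16)) ∂(permUniform N) ≤
      (permUniform N A)⁻¹ := by
  classical
  have hfin := sum_exp_permF_le A.toFinset (Set.toFinset_nonempty.2 hA)
  rw [Set.coe_toFinset] at hfin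
  have hc : (0 : ℝ) < A.toFinset.card := by
    exact_mod_cast (Set.toFinset_nonempty.2 hA).card_pos
  have hf : (0 : ℝ) < N.factorial := by exact_mod_cast N.factorial_pos
  have hcount : Measure.count A = (A.toFinset.card : ℝ≥0∞) := by
    rw [← Measure.count_apply_finset, Set.coe_toFinset]
  rw [permUniform, lintegral_smul_measure, lintegral_count, tsum_fintype,
    ← ENNReal.ofReal_sum_of_nonneg fun σ _ => (Real.exp_pos _).le, Measure.smul_apply, hcount,
    Fintype.card_perm, Fintype.card_fin, smul_eq_mul, smul_eq_mul]
  rw [← ENNReal.ofReal_natCast N.factorial, ← ENNReal.ofReal_natCast A.toFinset.card,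
    ← ENNReal.ofReal_inv_of_pos hf, ← ENNReal.ofReal_mul (by positivity),
    ← ENNReal.ofReal_mul (by positivity), ← ENNReal.ofReal_inv_of_pos (by positivity)]
  refine ENNReal.ofReal_le_ofReal ((mul_le_mul_of_nonneg_left hfin (by positivity)).trans
    (le_of_eq ?_))
  field_simp
end
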